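/- arXiv:1412.1937 — 2 statements merged into one kernel-verified Lean document; each statement's English description precedes it below -/
import Mathlib

section
/- Let c, c' : ℤ → ℂ both take values in {−1, 1}, let s ≥ 1, i ∈ ℤ and t ∈ {0, 1, …, s−1}. If c(l) = c'(l) for every integer l with i − s + t + 1 ≤ l ≤ i + t, then the matrix entries ((A^c)^s)_{i, i−s+2t} and ((A^{c'})^s)_{i, i−s+2t} are equal. (In other words, the entry ((A^c)^s)_{i, i−s+2t} depends only on the coefficients c(i−s+t+1), …, c(i+t).) -/
open scoped BigOperators

/-- `triDet n a` is the determinant of the `n×n` tridiagonal matrix with `-X` in every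
diagonal entry, `1` in every first-superdiagonal entry and `a 0, …, a (n-2)` in the
first-subdiagonal entries, viewed as a polynomial in `X` (for `n = 0` it is `1`).
With 0-based indexing, `triDet n (fun j => a (j+1))`-style shifts recover the paper's
`Δ(λ; a_1, …, a_{n−1})`. -/
noncomputable def triDet (n : ℕ) (a : ℕ → ℂ) : Polynomial ℂ :=
  (Matrix.of fun i j : Fin n =>
    if (i : ℕ) = (j : ℕ) then -Polynomial.X
    else if (i : ℕ) + 1 = (j : ℕ) then 1
    else if (i : ℕ) = (j : ℕ) + 1 then Polynomial.C (a (j : ℕ))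
    else 0).det

/-- The polynomial `p_k` for an `m`-tuple `k`, with 0-based indexing: `k 0 = k_1`, …,
`k (m-1) = k_m`.  `p_k = (-1)^m (Δ(λ; k_1, …, k_{m−1}) − k_m Δ(λ; k_2, …, k_{m−2}))`. -/
noncomputable def pPoly (m : ℕ) (k : ℕ → ℂ) : Polynomial ℂ :=
  (-1 : Polynomial ℂ) ^ m *
    (triDet m k - Polynomial.C (k (m - 1)) * triDet (m - 2) fun j => k (j + 1))

/-- The space `ℓ²(ℤ; ℂ)`. -/
abbrev Ell2Z : Type := lp (fun _ : ℤ => ℂ) 2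

/-- `A` is the hopping operator `A^c` associated to the sequence `c`:
`(A x)(i) = x(i+1) + c(i)·x(i−1)`. -/
def IsHopping (c : ℤ → ℂ) (A : Ell2Z →L[ℂ] Ell2Z) : Prop :=
  ∀ x : Ell2Z, ∀ i : ℤ, A x i = x (i + 1) + c i * x (i - 1)

/-- The `(i,j)` matrix entry of an operator `T` on `ℓ²(ℤ; ℂ)`: `T_{i,j} = (T e_j)(i)`. -/
noncomputable def entry (T : Ell2Z →L[ℂ] Ell2Z) (i j : ℤ) : ℂ :=
  T (lp.single 2 j (1 : ℂ)) i

/-- The first step of a path: the recursion for the entries of the powers of a hopping operator. -/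
theorem IsHopping.entry_pow_succ {c : ℤ → ℂ} {A : Ell2Z →L[ℂ] Ell2Z} (hA : IsHopping c A)
    (s : ℕ) (i j : ℤ) :
    entry (A ^ (s + 1)) i j = entry (A ^ s) (i + 1) j + c i * entry (A ^ s) (i - 1) j := by
  rw [entry, pow_succ']
  exact hA _ i

/-- The entries of the `s`-th power of a hopping operator vanish outside the band of width `s`. -/
theorem IsHopping.entry_pow_eq_zero {c : ℤ → ℂ} {A : Ell2Z →L[ℂ] Ell2Z} (hA : IsHopping c A)
    (s : ℕ) (i j t : ℤ) (hj : j = i - s + 2 * t) (ht : t < 0 ∨ (s : ℤ) < t) :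
    entry (A ^ s) i j = 0 := by
  induction s generalizing i t with
  | zero =>
    have hij : i ≠ j := by push_cast at *; omega
    simp [entry, lp.single_apply, hij]
  | succ s ih =>
    push_cast at hj ht
    rw [hA.entry_pow_succ, ih (i + 1) (t - 1) (by omega) (by omega),
      ih (i - 1) t (by omega) (by omega), mul_zero, add_zero]

/-- The entry of the `s`-th power at `(i, i - s + 2 * t)` is determined by the coefficients with
index in `[i - s + t + 1, i + t]`. -/
theorem IsHopping.entry_pow_congr {c c' : ℤ → ℂ} {A A' : Ell2Z →L[ℂ] Ell2Z}
    (hA : IsHopping c A) (hA' : IsHopping c' A') (s : ℕ) (i j t : ℤ)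
    (hj : j = i - s + 2 * t)
    (h : ∀ l : ℤ, i - s + t + 1 ≤ l → l ≤ i + t → c l = c' l) :
    entry (A ^ s) i j = entry (A' ^ s) i j := by
  induction s generalizing i t with
  | zero => rfl
  | succ s ih =>
    push_cast at hj h
    rw [hA.entry_pow_succ, hA'.entry_pow_succ,
      ih (i + 1) (t - 1) (by omega) fun l h₁ h₂ => h l (by omega) (by omega),
      ih (i - 1) t (by omega) fun l h₁ h₂ => h l (by omega) (by omega)]
    by_cases ht : t < 0 ∨ (s : ℤ) < t
    · rw [hA'.entry_pow_eq_zero s (i - 1) j t (by omega) ht, mul_zero, mul_zero]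
    · rw [h i (by omega) (by omega)]

/-- the entry `((A^c)^s)_{i, i−s+2t}` (for `t ∈ {0, …, s−1}`) only depends on
the coefficients `c(i−s+t+1), …, c(i+t)`. -/
theorem stmt_8 (c c' : ℤ → ℂ) (hc : ∀ i, c i = 1 ∨ c i = -1)
    (hc' : ∀ i, c' i = 1 ∨ c' i = -1)
    (A A' : Ell2Z →L[ℂ] Ell2Z) (hA : IsHopping c A) (hA' : IsHopping c' A')
    (s : ℕ) (hs : 1 ≤ s) (i : ℤ) (t : ℕ) (ht : t ≤ s - 1)
    (h : ∀ l : ℤ, i - (s : ℤ) + (t : ℤ) + 1 ≤ l → l ≤ i + (t : ℤ) → c l = c' l) :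
    entry (A ^ s) i (i - (s : ℤ) + 2 * (t : ℤ)) =
      entry (A' ^ s) i (i - (s : ℤ) + 2 * (t : ℤ)) := by
  exact hA.entry_pow_congr hA' s i _ t rfl h
end

section
/- Define Σ := { λ ∈ ℂ : there exists c : ℤ → ℂ with c(i) ∈ {−1, 1} for all i such that λ belongs to the spectrum of A^c }. Let m ≥ 2 and let k = (k_1, …, k_m) with entries in {−1, 1} generate a symmetry, i.e. k_{m−1} = −1, k_m = 1 and p_k = p_{k̂} where k̂ = (k_1, …, k_{m−2}, 1, −1). Then for every λ ∈ Σ there exists μ ∈ Σ with p_k(μ) = λ; that is, p_k^{−1}({λ}) ∩ Σ ≠ ∅ for every λ ∈ Σ. -/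
open scoped BigOperators

/-- The tuple `k̂ = (k_1, …, k_{m−2}, 1, −1)` obtained from `k` by replacing the last two
entries (0-based positions `m-2` and `m-1`) by `1` and `-1`. -/
noncomputable def khat (m : ℕ) (k : ℕ → ℂ) : ℕ → ℂ :=
  fun j => if j = m - 2 then 1 else if j = m - 1 then -1 else k j

/-- `k` generates a symmetry: `k_{m−1} = −1`, `k_m = 1` and `p_k = p_k̂`. -/
def GeneratesSymmetry (m : ℕ) (k : ℕ → ℂ) : Prop :=
  k (m - 2) = -1 ∧ k (m - 1) = 1 ∧ pPoly m k = pPoly m (khat m k)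

/-- The spectrum `Σ` of the Feinberg–Zee random hopping matrix: the union of the spectra
of all operators `A^c` with `c` taking values in `{−1, 1}`. -/
noncomputable def SigmaFZ : Set ℂ :=
  {lam : ℂ | ∃ c : ℤ → ℂ, (∀ i, c i = 1 ∨ c i = -1) ∧
    ∃ A : Ell2Z →L[ℂ] Ell2Z, IsHopping c A ∧ lam ∈ spectrum ℂ A}

lemma triDet_zero (a : ℕ → ℂ) : triDet 0 a = 1 := by simp [triDet]

lemma triDet_one (a : ℕ → ℂ) : triDet 1 a = -Polynomial.X := by simp [triDet]

lemma triDet_add_two (n : ℕ) (a : ℕ → ℂ) :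
    triDet (n + 2) a = -Polynomial.X * triDet (n + 1) (fun j => a (j + 1))
      - Polynomial.C (a 0) * triDet n (fun j => a (j + 2)) := by
  unfold triDet
  rw [Matrix.det_succ_row_zero, Fin.sum_univ_succ, Fin.sum_univ_succ, Finset.sum_eq_zero]
  · have key : ∀ A : Matrix (Fin (n + 1)) (Fin (n + 1)) (Polynomial ℂ),
        (∀ i : Fin n, A i.succ 0 = 0) →
          A.det = A 0 0 * (A.submatrix Fin.succ Fin.succ).det := by
      intro A hA
      rw [Matrix.det_succ_column_zero, Fin.sum_univ_succ, Finset.sum_eq_zero]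
      · simp
      · intro i _
        rw [hA]
        simp
    rw [key (Matrix.submatrix _ Fin.succ (Fin.succ 0).succAbove)]
    · simp [Matrix.submatrix, Fin.succAbove, Matrix.of_apply, ← sub_eq_add_neg]
    · intro i
      simp [Fin.succAbove]
  · intro i _
    simp

/-- The continuant with constant diagonal `t`: the determinant of the tridiagonal matrix with
diagonal entries `t`, superdiagonal entries `1` and subdiagonal entries `a 0, a 1, …`. -/
def continuant {R : Type*} [CommRing R] (t : R) (a : ℕ → R) : ℕ → R
  | 0 => 1
  | 1 => t
  | n + 2 => t * continuant t a (n + 1) - a n * continuant t a n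

section

variable {R M : Type*} [CommRing R] [AddCommGroup M] [Module R M]

lemma continuant_add_two_left (t : R) (a : ℕ → R) (n : ℕ) :
    continuant t a (n + 2) = t * continuant t (fun j => a (j + 1)) (n + 1)
      - a 0 * continuant t (fun j => a (j + 2)) n := by
  induction n using Nat.twoStepInduction with
  | zero => simp [continuant]
  | one => simp [continuant]; ring
  | more n h₀ h₁ =>
    simp only [continuant] at h₀ h₁ ⊢
    linear_combination t * h₁ - a (n + 2) * h₀

lemma continuant_congr (t : R) {a b : ℕ → R} {n : ℕ} (h : ∀ j, j + 1 < n → a j = b j) :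
    continuant t a n = continuant t b n := by
  induction n using Nat.twoStepInduction with
  | zero => rfl
  | one => rfl
  | more n h₀ h₁ =>
    rw [continuant, continuant, h₀ fun j hj => h j (by omega), h₁ fun j hj => h j (by omega),
      h n (by omega)]

lemma continuant_forward {t : R} {a d : ℕ → R} {f : ℕ → M}
    (hf : ∀ i, t • f (i + 1) = f (i + 2) + d (i + 1) • f i) (n : ℕ)
    (ha : ∀ i < n, d (i + 2) = a i) :
    f (n + 2) = continuant t a (n + 1) • f 1
      - (d 1 * continuant t (fun j => a (j + 1)) n) • f 0 := by
  induction n using Nat.twoStepInduction with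
  | zero =>
    simp only [continuant]
    linear_combination (norm := module) -hf 0
  | one =>
    have h := hf 0
    have h' := hf 1
    rw [ha 0 (by omega)] at h'
    simp only [continuant]
    linear_combination (norm := module) -h' - t • h
  | more n h₀ h₁ =>
    have h₀ := h₀ fun i hi => ha i (by omega)
    have h₁ := h₁ fun i hi => ha i (by omega)
    have h := hf (n + 2)
    rw [ha (n + 1) (by omega)] at h
    simp only [continuant] at h₀ h₁ ⊢
    linear_combination (norm := module) -h + t • h₁ - a (n + 1) • h₀

lemma continuant_backward {t : R} {a d : ℕ → R} {f : ℕ → M}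
    (hf : ∀ i, t • f (i + 1) = f (i + 2) + d (i + 1) • f i) (n : ℕ)
    (ha : ∀ i < n, d (i + 2) = a i) :
    continuant t a n • f (n + 2) - continuant t a (n + 1) • f (n + 1) =
      -(d 1 * ∏ i ∈ Finset.range n, a i) • f 0 := by
  induction n with
  | zero =>
    simp only [continuant, Finset.range_zero, Finset.prod_empty]
    linear_combination (norm := module) -hf 0
  | succ n ih =>
    have ih := ih fun i hi => ha i (by omega)
    have h := hf (n + 1)
    rw [ha n (by omega)] at h
    rw [Finset.prod_range_succ]
    simp only [continuant]
    linear_combination (norm := module) -continuant t a (n + 1) • h + a n • ih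

/-- Eliminating the interior of two consecutive blocks of length `n + 2` with the same interior
coefficients `a` from the three-term recurrence. -/
lemma continuant_block {t : R} {a : ℕ → R} {d : ℤ → R} {f : ℤ → M}
    (hf : ∀ i, t • f i = f (i + 1) + d i • f (i - 1)) (n : ℕ) (z : ℤ)
    (ha : ∀ i : ℕ, i < n → d (z + i + 2) = a i)
    (ha' : ∀ i : ℕ, i < n → d (z - (n + 2) + i + 2) = a i) :
    (t * continuant t a (n + 1) - d (z + 1) * continuant t (fun j => a (j + 1)) n
        - d z * continuant t a n) • f z =
      f (z + (n + 2)) +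
        (d z * d (z - (n + 2) + 1) * ∏ i ∈ Finset.range n, a i) • f (z - (n + 2)) := by
  have hs : ∀ (w : ℤ) (i : ℕ), t • f (w + (i + 1 : ℕ)) =
      f (w + (i + 2 : ℕ)) + d (w + (i + 1 : ℕ)) • f (w + i) := by
    intro w i
    rw [hf]
    push_cast
    ring_nf
  have h₁ := continuant_forward (f := fun i : ℕ => f (z + i)) (d := fun i : ℕ => d (z + i))
    (a := a)
    (hs z) n (fun i hi => by rw [← ha i hi]; push_cast; ring_nf)
  have h₂ := continuant_backward (f := fun i : ℕ => f (z - (n + 2) + i))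
    (d := fun i : ℕ => d (z - (n + 2) + i))
    (a := a) (hs (z - (n + 2))) n (fun i hi => by rw [← ha' i hi]; push_cast; ring_nf)
  have e₁ : z - ((n : ℤ) + 2) + (n + 2 : ℕ) = z := by push_cast; ring
  have e₂ : z - ((n : ℤ) + 2) + (n + 1 : ℕ) = z - 1 := by push_cast; ring
  simp only [e₁, e₂] at h₂
  push_cast at h₁ h₂
  rw [add_zero] at h₁ h₂
  have h := hf z
  linear_combination (norm := module) continuant t a (n + 1) • h - h₁ - d z • h₂

end

lemma triDet_eq_continuant (n : ℕ) (a : ℕ → ℂ) :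
    triDet n a = (-1) ^ n * continuant Polynomial.X (fun j => Polynomial.C (a j)) n := by
  induction n using Nat.twoStepInduction generalizing a with
  | zero => simp [triDet_zero, continuant]
  | one => simp [triDet_one, continuant]
  | more n h₀ h₁ =>
    rw [triDet_add_two, h₀, h₁, continuant_add_two_left]
    ring

lemma pPoly_add_two (n : ℕ) (k : ℕ → ℂ) :
    pPoly (n + 2) k =
      Polynomial.X * continuant Polynomial.X (fun j => Polynomial.C (k j)) (n + 1)
        - Polynomial.C (k (n + 1)) *
          continuant Polynomial.X (fun j => Polynomial.C (k (j + 1))) n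
        - Polynomial.C (k n) * continuant Polynomial.X (fun j => Polynomial.C (k j)) n := by
  have h : ((-1 : Polynomial ℂ) ^ n) ^ 2 = 1 := by rw [← pow_mul, mul_comm, pow_mul]; simp
  simp only [pPoly, triDet_eq_continuant, continuant, Nat.add_sub_cancel,
    show n + 2 - 1 = n + 1 from rfl]
  linear_combination (Polynomial.X * continuant Polynomial.X (fun j => Polynomial.C (k j)) (n + 1)
        - Polynomial.C (k (n + 1)) *
          continuant Polynomial.X (fun j => Polynomial.C (k (j + 1))) n
        - Polynomial.C (k n) * continuant Polynomial.X (fun j => Polynomial.C (k j)) n) * h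

/-- A symmetry-generating tuple has the same continuant after deleting its first or its last
interior site. -/
lemma GeneratesSymmetry.continuant_eq {n : ℕ} {k : ℕ → ℂ} (h : GeneratesSymmetry (n + 2) k) :
    continuant Polynomial.X (fun j => Polynomial.C (k (j + 1))) n =
      continuant Polynomial.X (fun j => Polynomial.C (k j)) n := by
  obtain ⟨h₁, h₂, h₃⟩ := h
  simp only [Nat.add_sub_cancel, show n + 2 - 1 = n + 1 from rfl] at h₁ h₂
  have hk : ∀ j < n, khat (n + 2) k j = k j := fun j hj => by
    rw [khat, if_neg (by omega), if_neg (by omega)]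
  have hn : khat (n + 2) k n = 1 := by simp [khat]
  have hn' : khat (n + 2) k (n + 1) = -1 := by simp [khat]
  rw [pPoly_add_two, pPoly_add_two, h₁, h₂, hn, hn',
    continuant_congr (n := n + 1) (a := fun j => Polynomial.C (khat (n + 2) k j)) _
      (fun j hj => by rw [hk j (by omega)]),
    continuant_congr (n := n) (a := fun j => Polynomial.C (khat (n + 2) k (j + 1))) _
      (fun j hj => by rw [hk (j + 1) (by omega)]),
    continuant_congr (n := n) (a := fun j => Polynomial.C (khat (n + 2) k j)) _
      (fun j hj => by rw [hk j (by omega)])] at h₃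
  simp only [map_neg, map_one] at h₃
  refine mul_left_cancel₀ (two_ne_zero (α := Polynomial ℂ)) ?_
  linear_combination -h₃

open Polynomial in
lemma aeval_dualMap_apply {V : Type*} [NormedAddCommGroup V] [NormedSpace ℂ V] (A : V →L[ℂ] V)
    (p : ℂ[X]) (φ : Module.Dual ℂ V) (x : V) :
    aeval (A : V →ₗ[ℂ] V).dualMap p φ x = φ (aeval A p x) := by
  induction p using Polynomial.induction_on' generalizing x with
  | add p q hp hq => simp [hp, hq]
  | monomial n a =>
    rw [aeval_monomial, aeval_monomial]
    simp only [Algebra.algebraMap_eq_smul_one, smul_mul_assoc, one_mul, LinearMap.smul_apply,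
      smul_apply, map_smul]
    congr 1
    induction n generalizing x with
    | zero => simp
    | succ n ih => rw [pow_succ', pow_succ]; simpa using ih (A x)

/-- If the coefficients `d` consist of blocks whose interiors are given by `k` and whose boundary
coefficients are opposite to each other, then `p_k` of the hopping operator acts as a hopping
operator on the sites at the block boundaries. -/
lemma IsHopping.aeval_pPoly_apply {n : ℕ} {k : ℕ → ℂ} (hk : GeneratesSymmetry (n + 2) k)
    {d : ℤ → ℂ} {A : Ell2Z →L[ℂ] Ell2Z} (hA : IsHopping d A) (z : ℤ)
    (ha : ∀ i : ℕ, i < n → d (z + i + 2) = k i)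
    (ha' : ∀ i : ℕ, i < n → d (z - (n + 2) + i + 2) = k i)
    (hz : d (z + 1) = - d z) (x : Ell2Z) :
    (Polynomial.aeval A (pPoly (n + 2) k) x : Ell2Z) z = x (z + (n + 2)) +
      (d z * d (z - (n + 2) + 1) * ∏ i ∈ Finset.range n, k i) * x (z - (n + 2)) := by
  let φ : ℤ → Module.Dual ℂ Ell2Z := fun i =>
    { toFun := fun x => x i, map_add' := fun _ _ => rfl, map_smul' := fun _ _ => rfl }
  have hC : ∀ (c : ℂ) (ψ : Module.Dual ℂ Ell2Z), Polynomial.C c •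
      Module.AEval'.of (A : Ell2Z →ₗ[ℂ] Ell2Z).dualMap ψ = Module.AEval'.of _ (c • ψ) := by
    intro c ψ
    rw [← Module.AEval.of_aeval_smul]
    simp
  have h := continuant_block (t := (Polynomial.X : Polynomial ℂ))
    (a := fun i => Polynomial.C (k i)) (d := fun i => Polynomial.C (d i))
    (f := fun i => Module.AEval'.of (A : Ell2Z →ₗ[ℂ] Ell2Z).dualMap (φ i))
    (fun i => by
      rw [Module.AEval'.X_smul_of, hC, ← map_add]
      congr 1
      ext x
      exact hA x i) n z (fun i hi => by simp only [ha i hi]) (fun i hi => by simp only [ha' i hi])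
  have hp : Polynomial.X * continuant Polynomial.X (fun i => Polynomial.C (k i)) (n + 1)
      - Polynomial.C (d (z + 1)) * continuant Polynomial.X (fun i => Polynomial.C (k (i + 1))) n
      - Polynomial.C (d z) * continuant Polynomial.X (fun i => Polynomial.C (k i)) n =
      pPoly (n + 2) k := by
    obtain ⟨h₁, h₂, -⟩ := id hk
    simp only [Nat.add_sub_cancel, show n + 2 - 1 = n + 1 from rfl] at h₁ h₂
    rw [pPoly_add_two, hk.continuant_eq, hz, h₁, h₂]
    simp only [map_neg, map_one]
    ring
  simp only [← map_prod, ← map_mul, hC] at h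
  rw [hp, ← Module.AEval.of_aeval_smul, ← map_add] at h
  have h' := LinearMap.congr_fun ((Module.AEval'.of _).injective h) x
  exact (aeval_dualMap_apply A _ _ x).symm.trans h'

/-- Every sign sequence on `ℤ` is the sequence of successive ratios of a sign sequence. -/
lemma exists_sign_mul_pred {e : ℤ → ℂ} (he : ∀ i, e i = 1 ∨ e i = -1) :
    ∃ s : ℤ → ℂ, (∀ i, s i = 1 ∨ s i = -1) ∧ ∀ i, s i * s (i - 1) = e i := by
  have hs : ∀ s : ℕ → ℂ, (∀ i, s i = 1 ∨ s i = -1) → ∀ n,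
      ∏ i ∈ Finset.range n, s i = 1 ∨ ∏ i ∈ Finset.range n, s i = -1 := by
    intro s hs n
    induction n with
    | zero => simp
    | succ n ih =>
      rw [Finset.prod_range_succ]
      rcases ih with h | h <;> rcases hs n with h' | h' <;> simp [h, h']
  have sq : ∀ w : ℂ, w = 1 ∨ w = -1 → w * w = 1 := by rintro w (rfl | rfl) <;> simp
  obtain ⟨s, h_ofNat, h_negSucc⟩ : ∃ s : ℤ → ℂ,
      (∀ n : ℕ, s (Int.ofNat n) = ∏ i ∈ Finset.range n, e (i + 1)) ∧
      ∀ n : ℕ, s (Int.negSucc n) = ∏ i ∈ Finset.range (n + 1), e (-i) :=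
    ⟨fun i => match i with
      | Int.ofNat n => ∏ i ∈ Finset.range n, e (i + 1)
      | Int.negSucc n => ∏ i ∈ Finset.range (n + 1), e (-i), fun _ => rfl, fun _ => rfl⟩
  refine ⟨s, ?_, ?_⟩
  · rintro (n | n)
    · rw [h_ofNat]
      exact hs (fun i => e (i + 1)) (fun i => he _) n
    · rw [h_negSucc]
      exact hs (fun i => e (-i)) (fun i => he _) (n + 1)
  · rintro ((_ | n) | n)
    · rw [show Int.ofNat 0 - 1 = Int.negSucc 0 from rfl, h_ofNat, h_negSucc]
      simp
    · have h := sq _ (hs (fun i => e (i + 1)) (fun i => he _) n)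
      rw [show Int.ofNat (n + 1) - 1 = Int.ofNat n by simp, h_ofNat, h_ofNat,
        Finset.prod_range_succ, Int.ofNat_eq_natCast]
      push_cast
      linear_combination e (n + 1) * h
    · have h := sq _ (hs (fun i => e (-i)) (fun i => he _) (n + 1))
      rw [show Int.negSucc n - 1 = Int.negSucc (n + 1) by omega, h_negSucc, h_negSucc,
        Finset.prod_range_succ _ (n + 1), Int.negSucc_eq]
      push_cast at h ⊢
      linear_combination e (-(n + 1)) * h

lemma memℓp_two_iff {f : ℤ → ℂ} : Memℓp f 2 ↔ Summable fun i => ‖f i‖ ^ 2 := by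
  rw [memℓp_gen_iff (by simp)]
  simp

lemma exists_weighted_shift (w : ℤ → ℂ) (hw : ∀ i, w i = 1 ∨ w i = -1) (e : ℤ ≃ ℤ) :
    ∃ T : Ell2Z →L[ℂ] Ell2Z, ∀ (x : Ell2Z) (i : ℤ), T x i = w i * x (e i) := by
  have hn : ∀ (x : Ell2Z) (i : ℤ), ‖w i * x (e i)‖ = ‖x (e i)‖ := by
    intro x i
    rcases hw i with h | h <;> simp [h]
  have hmem : ∀ x : Ell2Z, Memℓp (fun i => w i * x (e i)) 2 := by
    intro x
    rw [memℓp_two_iff]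
    simp only [hn]
    exact (e.summable_iff (f := fun i => ‖x i‖ ^ 2)).2 (memℓp_two_iff.1 (lp.memℓp x))
  let T : Ell2Z →ₗ[ℂ] Ell2Z :=
    { toFun := fun x => ⟨fun i => w i * x (e i), hmem x⟩
      map_add' := fun x y => by ext i; exact mul_add _ _ _
      map_smul' := fun c x => by ext i; exact mul_left_comm _ _ _ }
  refine ⟨T.mkContinuous 1 fun x => ?_, fun x i => rfl⟩
  rw [one_mul, lp.norm_eq_tsum_rpow (by simp), lp.norm_eq_tsum_rpow (by simp)]
  refine le_of_eq (congrArg (· ^ _) ?_)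
  exact (tsum_congr fun i => congrArg (· ^ _) (hn x i)).trans
    (e.tsum_eq fun i => ‖x i‖ ^ (2 : ENNReal).toReal)

lemma exists_isHopping {c : ℤ → ℂ} (hc : ∀ i, c i = 1 ∨ c i = -1) :
    ∃ A : Ell2Z →L[ℂ] Ell2Z, IsHopping c A := by
  obtain ⟨S, hS⟩ := exists_weighted_shift (fun _ => 1) (fun _ => Or.inl rfl) (Equiv.addRight 1)
  obtain ⟨T, hT⟩ := exists_weighted_shift c hc (Equiv.subRight 1)
  refine ⟨S + T, fun x i => ?_⟩
  have h := congrArg₂ (· + ·) (hS x i) (hT x i)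
  simp only [one_mul, Equiv.coe_addRight, Equiv.subRight_apply] at h
  exact h


lemma summable_sign_mul {D : ℤ → ℂ} (hD : ∀ i, D i = 1 ∨ D i = -1) (x y : Ell2Z) (a : ℤ) :
    Summable fun i => D i * x i * y (i + a) := by
  have hx := memℓp_two_iff.1 (lp.memℓp x)
  have hy := ((Equiv.addRight a).summable_iff (f := fun i => ‖y i‖ ^ 2)).2
    (memℓp_two_iff.1 (lp.memℓp y))
  refine Summable.of_norm_bounded (hx.add hy) fun i => ?_
  have hDi : ‖D i‖ = 1 := by rcases hD i with h | h <;> simp [h]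
  simp only [Function.comp_apply, Equiv.coe_addRight, norm_mul, hDi, one_mul]
  nlinarith [sq_nonneg (‖x i‖ - ‖y (i + a)‖), sq_nonneg (‖x i‖ + ‖y (i + a)‖)]

/-- The operator `A^c - λ` is symmetric for a diagonal bilinear form, so it is injective as soon
as it is surjective. -/
lemma IsHopping.injective_of_surjective {c : ℤ → ℂ} (hc : ∀ i, c i = 1 ∨ c i = -1)
    {A : Ell2Z →L[ℂ] Ell2Z} (hA : IsHopping c A) {l : ℂ}
    (hs : Function.Surjective (A - algebraMap ℂ (Ell2Z →L[ℂ] Ell2Z) l)) :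
    Function.Injective (A - algebraMap ℂ (Ell2Z →L[ℂ] Ell2Z) l) := by
  have hB : ∀ (x : Ell2Z) (i : ℤ), (A - algebraMap ℂ (Ell2Z →L[ℂ] Ell2Z) l) x i =
      x (i + 1) + c i * x (i - 1) - l * x i := by
    intro x i
    rw [← hA x i]
    rfl
  obtain ⟨D, hD, hDc⟩ := exists_sign_mul_pred hc
  have hpred : ∀ i, D i * c i = D (i - 1) := fun i => by
    rw [← hDc i]
    rcases hD i with h | h <;> simp [h]
  rw [injective_iff_map_eq_zero]
  intro y hy
  ext i
  obtain ⟨x, hx⟩ := hs (lp.single 2 i 1)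
  have h₁ := (summable_sign_mul hD x y 1).hasSum
  have h₂ := (summable_sign_mul hD y x 1).hasSum
  have h₃ := (summable_sign_mul hD x y 0).hasSum
  have h₁' := (Equiv.subRight (1 : ℤ)).hasSum_iff.2 h₁
  have h₂' := (Equiv.subRight (1 : ℤ)).hasSum_iff.2 h₂
  have hl := (h₂.add h₁').sub (h₃.mul_left l)
  have hr := (h₁.add h₂').sub (h₃.mul_left l)
  have hval : ∀ z, D z * y z * (lp.single 2 i (1 : ℂ) : Ell2Z) z =
      if z = i then D i * y i else 0 := by
    intro z
    rw [lp.single_apply, Pi.single_apply]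
    split_ifs with h
    · rw [h, mul_one]
    · rw [mul_zero]
  have hl₀ := hl.unique ((hasSum_ite_eq i (D i * y i)).congr_fun fun z => by
    rw [← hval z, ← hx, hB]
    simp only [Function.comp_apply, Equiv.subRight_apply, sub_add_cancel, add_zero]
    linear_combination -(x (z - 1) * y z * hpred z))
  have hr₀ := hr.unique ((hasSum_zero (α := ℂ) (β := ℤ)).congr_fun fun z => by
    have h := hB y z
    rw [hy] at h
    have h' : (0 : ℂ) = y (z + 1) + c z * y (z - 1) - l * y z := h
    simp only [Function.comp_apply, Equiv.subRight_apply, sub_add_cancel, add_zero]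
    linear_combination -(y (z - 1) * x z * hpred z) - D z * x z * h')
  have h : D i * y i = 0 := by
    linear_combination hr₀ - hl₀
  rcases hD i with h' | h' <;> simpa [h'] using h

lemma exists_extension {N : ℤ} (hN : N ≠ 0) (y : Ell2Z) :
    ∃ w : Ell2Z, ∀ j, w (N * j) = y j := by
  have hinj : Function.Injective fun j : ℤ => N * j := mul_right_injective₀ hN
  have happ : ∀ j, Function.extend (fun j : ℤ => N * j) y 0 (N * j) = y j :=
    fun j => hinj.extend_apply y 0 j
  refine ⟨⟨Function.extend (fun j : ℤ => N * j) y 0, ?_⟩, happ⟩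
  refine memℓp_two_iff.2 ((hinj.summable_iff fun i hi => ?_).1 ?_)
  · rw [Function.extend_apply' _ _ _ hi]
    simp
  · simpa only [Function.comp_def, happ] using memℓp_two_iff.1 (lp.memℓp y)

lemma exists_restriction {N : ℤ} (hN : N ≠ 0) (x : Ell2Z) :
    ∃ v : Ell2Z, ∀ j, v j = x (N * j) :=
  ⟨⟨fun j => x (N * j), memℓp_two_iff.2
    ((memℓp_two_iff.1 (lp.memℓp x)).comp_injective (mul_right_injective₀ hN))⟩, fun _ => rfl⟩

/-- The coefficients whose restriction to the block boundaries realises `c`. -/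
lemma exists_block_coefficients {n : ℕ} {k : ℕ → ℂ} (hk : ∀ j, k j = 1 ∨ k j = -1)
    {c : ℤ → ℂ} (hc : ∀ i, c i = 1 ∨ c i = -1) :
    ∃ d : ℤ → ℂ, (∀ i, d i = 1 ∨ d i = -1) ∧
      (∀ (j : ℤ) (i : ℕ), i < n → d ((n + 2) * j + i + 2) = k i) ∧
      (∀ j : ℤ, d ((n + 2) * j + 1) = -d ((n + 2) * j)) ∧
      ∀ j : ℤ, d ((n + 2) * j) * d ((n + 2) * (j - 1) + 1) * ∏ i ∈ Finset.range n, k i = c j := by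
  have hP : ∀ n, ∏ i ∈ Finset.range n, k i = 1 ∨ ∏ i ∈ Finset.range n, k i = -1 := by
    intro n
    induction n with
    | zero => simp
    | succ n ih =>
      rw [Finset.prod_range_succ]
      rcases ih with h | h <;> rcases hk n with h' | h' <;> simp [h, h']
  obtain ⟨s, hs, hsc⟩ := exists_sign_mul_pred
    (e := fun j => -(c j * ∏ i ∈ Finset.range n, k i)) fun j => by
      rcases hP n with h | h <;> rcases hc j with h' | h' <;> simp [h, h']
  let g : ℤ → ℤ → ℂ := fun q r =>
    if r = 0 then s q else if r = 1 then -s q else k (r - 2).toNat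
  let d : ℤ → ℂ := fun i => g (i / (n + 2)) (i % (n + 2))
  have hd : ∀ j r : ℤ, 0 ≤ r → r < n + 2 → d ((n + 2) * j + r) = g j r := by
    intro j r h₀ h₁
    have hq : ((n + 2) * j + r) / ((n : ℤ) + 2) = j := by
      rw [Int.mul_add_ediv_left _ _ (by omega), Int.ediv_eq_zero_of_lt h₀ h₁, add_zero]
    have hr : ((n + 2) * j + r) % ((n : ℤ) + 2) = r := by
      rw [Int.mul_add_emod_self_left, Int.emod_eq_of_lt h₀ h₁]
    simp only [d, hq, hr]
  have hd₀ : ∀ j : ℤ, d ((n + 2) * j) = s j := by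
    intro j
    simpa [g] using hd j 0 le_rfl (by omega)
  have hd₁ : ∀ j : ℤ, d ((n + 2) * j + 1) = -s j := by
    intro j
    simpa [g] using hd j 1 zero_le_one (by omega)
  refine ⟨d, fun i => ?_, fun j i hi => ?_, fun j => ?_, fun j => ?_⟩
  · simp only [d, g]
    split_ifs
    · exact hs _
    · rcases hs (i / (n + 2)) with h | h <;> simp [h]
    · exact hk _
  · rw [add_assoc, hd j _ (by omega) (by omega)]
    simp only [g]
    rw [if_neg (by omega), if_neg (by omega)]
    congr 1
    omega
  · rw [hd₀, hd₁]
  · rw [hd₀, hd₁]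
    have h : (∏ i ∈ Finset.range n, k i) ^ 2 = 1 := by rcases hP n with h | h <;> simp [h]
    linear_combination -(∏ i ∈ Finset.range n, k i) * hsc j + c j * h

/-- if `k` generates a symmetry, then `p_k⁻¹({λ}) ∩ Σ ≠ ∅` for every
`λ ∈ Σ`. -/
theorem stmt_18 (m : ℕ) (hm : 2 ≤ m) (k : ℕ → ℂ) (hk : ∀ j, k j = 1 ∨ k j = -1)
    (hsym : GeneratesSymmetry m k) (lam : ℂ) (hlam : lam ∈ SigmaFZ) :
    ∃ μ ∈ SigmaFZ, (pPoly m k).eval μ = lam := by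
  obtain ⟨n, rfl⟩ := Nat.exists_eq_add_of_le' hm
  obtain ⟨c, hc, A, hA, hspec⟩ := hlam
  obtain ⟨d, hd, hdk, hd₁, hdc⟩ := exists_block_coefficients (n := n) hk hc
  obtain ⟨T, hT⟩ := exists_isHopping hd
  have hN : (n : ℤ) + 2 ≠ 0 := by omega
  have : Nontrivial Ell2Z :=
    ⟨lp.single 2 0 1, 0, fun h => by simpa using congrArg (fun x : Ell2Z => x 0) h⟩
  suffices h : lam ∈ spectrum ℂ (Polynomial.aeval T (pPoly (n + 2) k)) by
    rw [spectrum.map_polynomial_aeval] at h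
    obtain ⟨μ, hμ, h⟩ := h
    exact ⟨μ, ⟨d, hd, T, hT, hμ⟩, h⟩
  have hpT : ∀ (x : Ell2Z) (j : ℤ),
      (Polynomial.aeval T (pPoly (n + 2) k) x : Ell2Z) ((n + 2) * j) =
        x ((n + 2) * (j + 1)) + c j * x ((n + 2) * (j - 1)) := by
    intro x j
    have e : ((n : ℤ) + 2) * j - (n + 2) = (n + 2) * (j - 1) := by ring
    have e' : ((n : ℤ) + 2) * j + (n + 2) = (n + 2) * (j + 1) := by ring
    rw [hT.aeval_pPoly_apply hsym _ (hdk j) (by rw [e]; exact hdk (j - 1)) (hd₁ j), e, hdc, e']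
  by_contra hres
  refine hspec ?_
  rw [spectrum.mem_resolventSet_iff, ← neg_sub, IsUnit.neg_iff,
    ContinuousLinearMap.isUnit_iff_bijective]
  rw [spectrum.notMem_iff, ← neg_sub, IsUnit.neg_iff,
    ContinuousLinearMap.isUnit_iff_bijective] at hres
  have hsurj : Function.Surjective (A - algebraMap ℂ (Ell2Z →L[ℂ] Ell2Z) lam) := by
    intro y
    obtain ⟨w, hw⟩ := exists_extension hN y
    obtain ⟨x, hx⟩ := hres.2 w
    obtain ⟨v, hv⟩ := exists_restriction hN x
    refine ⟨v, ?_⟩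
    ext j
    rw [← hw, ← hx]
    change A v j - lam * v j =
      (Polynomial.aeval T (pPoly (n + 2) k) x : Ell2Z) ((n + 2) * j) - lam * x ((n + 2) * j)
    rw [hA, hpT, hv, hv, hv]
  exact ⟨hA.injective_of_surjective hc hsurj, hsurj⟩
end
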